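/- Let G be a Lie group acting smoothly on a finite-dimensional manifold M, inducing an action on the nonlinear Grassmannian Gr(M), and let N ∈ Gr(M). If G has good orbit and good isotropy at N, then the G-equivariant orbit map G → G·N, g ↦ g·N, is a smooth principal bundle with structure group the isotropy group G_N. -/

import Mathlib

/-!
Abstract framework for the convenient (Kriegl–Michor) calculus used in
"Nonlinear Grassmannians: plain, decorated, augmented" (Haller–Vizman):
smooth structures recorded by their smooth curves, convenient/regular Lie groups,
smooth actions admitting local smooth sections, abstract (kinematic) tangent data,
fundamental vector fields, smooth principal/fiber bundles and good coadjoint orbits.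
-/

open Function

/-- A convenient smooth structure on a type, abstracted by its set of smooth curves
(in convenient calculus all smoothness notions are detected by smooth curves). -/
class SmoothCurves (X : Type*) where
  curves : Set (ℝ → X)
  const_mem : ∀ x : X, (fun _ : ℝ => x) ∈ curves

/-- Convenient smoothness: a map is smooth if it maps smooth curves to smooth curves. -/
def CSmooth {X Y : Type*} [SmoothCurves X] [SmoothCurves Y] (f : X → Y) : Prop :=
  ∀ c ∈ SmoothCurves.curves (X := X), (fun t => f (c t)) ∈ SmoothCurves.curves (X := Y)

noncomputable instance : SmoothCurves ℝ where
  curves := {c | ContDiff ℝ (⊤ : ℕ∞) c}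
  const_mem _ := by simp only [Set.mem_setOf_eq]; exact contDiff_const

instance {X Y : Type*} [SmoothCurves X] [SmoothCurves Y] : SmoothCurves (X × Y) where
  curves := {c | (fun t => (c t).1) ∈ SmoothCurves.curves ∧
    (fun t => (c t).2) ∈ SmoothCurves.curves}
  const_mem x := ⟨SmoothCurves.const_mem x.1, SmoothCurves.const_mem x.2⟩

instance {X : Type*} [SmoothCurves X] {p : X → Prop} : SmoothCurves (Subtype p) where
  curves := {c | (fun t => (c t : X)) ∈ SmoothCurves.curves}
  const_mem x := SmoothCurves.const_mem (x : X)

/-- A convenient Lie group: a group with smooth multiplication and inversion. -/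
class ConvenientLieGroup (G : Type*) [Group G] [SmoothCurves G] : Prop where
  smooth_mul : CSmooth fun p : G × G => p.1 * p.2
  smooth_inv : CSmooth fun g : G => g⁻¹

/-- A smooth action of a convenient Lie group on a smooth space. -/
class SmoothAction (G Q : Type*) [Group G] [SmoothCurves G] [SmoothCurves Q]
    [MulAction G Q] : Prop where
  smooth_smul : CSmooth fun p : G × Q => p.1 • p.2

/-- The action of `G` on `Q` admits local smooth sections: around every point `x`
there is an open neighbourhood `U` and a smooth map `u : U → G` with `u(y)·x = y`
for all `y ∈ U`. -/
def AdmitsLocalSmoothSections (G Q : Type*) [SmoothCurves G] [SmoothCurves Q]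
    [TopologicalSpace Q] [SMul G Q] : Prop :=
  ∀ x : Q, ∃ U : Set Q, IsOpen U ∧ x ∈ U ∧
    ∃ u : U → G, CSmooth u ∧ ∀ y : U, u y • x = (y : Q)

/-- Local smooth sections for the action of a subgroup `Gsub` of an ambient regular
Lie group `H`: the sections take values in `Gsub` but are only required to be smooth
as `H`-valued maps. -/
def AdmitsLocalSmoothSectionsSub (H : Type*) [Group H] [SmoothCurves H] (Gsub : Subgroup H)
    (Q : Type*) [SmoothCurves Q] [TopologicalSpace Q] [SMul H Q] : Prop :=
  ∀ x : Q, ∃ U : Set Q, IsOpen U ∧ x ∈ U ∧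
    ∃ u : U → H, CSmooth u ∧ ∀ y : U, u y ∈ Gsub ∧ u y • x = (y : Q)

/-- Regularity of a convenient Lie group `G` with Lie algebra `𝔤`: smooth curves in
the Lie algebra integrate, via the right evolution operator, to smooth curves in the
group, smoothly in the curve; the right logarithmic derivative is abstract data. -/
structure Regularity (G 𝔤 : Type*) [Group G] [SmoothCurves G] [SmoothCurves 𝔤] where
  evolRight : (ℝ → 𝔤) → ℝ → G
  evolRight_zero : ∀ c, evolRight c 0 = 1
  evolRight_smooth : ∀ c ∈ SmoothCurves.curves (X := 𝔤),
    evolRight c ∈ SmoothCurves.curves (X := G)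
  rightLogDeriv : (ℝ → G) → ℝ → 𝔤
  rightLogDeriv_evolRight : ∀ c ∈ SmoothCurves.curves (X := 𝔤),
    rightLogDeriv (evolRight c) = c

/-- Abstract kinematic tangent bundle data for a smooth space `Q`:
a total space `TQ`, projection, zero section and the kinematic derivative of curves. -/
structure TangentData (Q TQ : Type*) [SmoothCurves Q] [SmoothCurves TQ] where
  proj : TQ → Q
  smooth_proj : CSmooth proj
  zero : Q → TQ
  proj_zero : ∀ q, proj (zero q) = q
  deriv : (ℝ → Q) → ℝ → TQ
  proj_deriv : ∀ c t, proj (deriv c t) = c t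
  deriv_const : ∀ (q : Q) (t : ℝ), deriv (fun _ => q) t = zero q

/-- The fundamental vector field `ζ_X(q) = ∂ₜ|₀ (exp tX)·q` of a smooth action,
expressed through the right evolution of the constant curve `X` and the kinematic
derivative. -/
def fundVF {G 𝔤 Q TQ : Type*} [Group G] [SmoothCurves G] [SmoothCurves 𝔤]
    [SmoothCurves Q] [SmoothCurves TQ] [MulAction G Q]
    (reg : Regularity G 𝔤) (tang : TangentData Q TQ) (X : 𝔤) (q : Q) : TQ :=
  tang.deriv (fun t => reg.evolRight (fun _ => X) t • q) 0

/-- The coadjoint action on `𝔤*` (bounded linear functionals on `𝔤`), determined by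
adjoint action data `Ad`. -/
def coadAct {G 𝔤 : Type*} [Group G] [AddCommGroup 𝔤] [Module ℝ 𝔤]
    (Ad : G →* Module.End ℝ 𝔤) (g : G) (ξ : Module.Dual ℝ 𝔤) : Module.Dual ℝ 𝔤 :=
  ξ.comp (Ad g⁻¹)

/-- The infinitesimal coadjoint action `ad*_X ξ = −ξ ∘ ad_X`. -/
def coadInf {𝔤 : Type*} [LieRing 𝔤] [LieAlgebra ℝ 𝔤]
    (X : 𝔤) (ξ : Module.Dual ℝ 𝔤) : Module.Dual ℝ 𝔤 :=
  -(ξ.comp (LieAlgebra.ad ℝ 𝔤 X))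

/-- A *good* coadjoint orbit: a coadjoint orbit which admits a (Fréchet) smooth
structure such that the coadjoint action on it is smooth and admits local smooth
sections. -/
def IsGoodCoadjointOrbit {G 𝔤 : Type*} [Group G] [SmoothCurves G]
    [AddCommGroup 𝔤] [Module ℝ 𝔤] (Ad : G →* Module.End ℝ 𝔤)
    (O : Set (Module.Dual ℝ 𝔤)) : Prop :=
  (∃ ξ₀ ∈ O, O = Set.range fun g : G => coadAct Ad g ξ₀) ∧
  ∃ (τ : TopologicalSpace O) (σ : SmoothCurves O) (act : G → O → O),
    (∀ (g : G) (ξ : O), (act g ξ : Module.Dual ℝ 𝔤) = coadAct Ad g ξ) ∧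
    (letI := σ; CSmooth fun p : G × O => act p.1 p.2) ∧
    (letI := τ; letI := σ;
      ∀ ξ : O, ∃ U : Set O, IsOpen U ∧ ξ ∈ U ∧
        ∃ u : U → G, CSmooth u ∧ ∀ η : U, act (u η) ξ = (η : O))

/-- `π : P → B` is a smooth principal bundle with structure group `H` acting
(on the right) via `ract`. -/
structure IsSmoothPrincipalBundle (H P B : Type*) [Group H] [SmoothCurves H]
    [SmoothCurves P] [SmoothCurves B] [TopologicalSpace B]
    (π : P → B) (ract : P → H → P) : Prop where
  smooth_proj : CSmooth π
  surj : Function.Surjective π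
  ract_one : ∀ p, ract p 1 = p
  ract_mul : ∀ p h h', ract (ract p h) h' = ract p (h * h')
  smooth_ract : CSmooth fun q : P × H => ract q.1 q.2
  proj_ract : ∀ p h, π (ract p h) = π p
  free : ∀ p h, ract p h = p → h = 1
  locTriv : ∀ b : B, ∃ U : Set B, IsOpen U ∧ b ∈ U ∧
    ∃ φ : {p : P // π p ∈ U} ≃ U × H,
      CSmooth ⇑φ ∧ CSmooth ⇑φ.symm ∧
      (∀ p : {p : P // π p ∈ U}, ((φ p).1 : B) = π (p : P)) ∧
      (∀ p q : {p : P // π p ∈ U}, ∀ h : H,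
        (q : P) = ract (p : P) h → (φ q).2 = (φ p).2 * h)

/-- `π : E → B` is a smooth (locally trivial) fiber bundle with typical fiber `F`. -/
structure IsSmoothFiberBundle (F E B : Type*) [SmoothCurves F] [SmoothCurves E]
    [SmoothCurves B] [TopologicalSpace B] (π : E → B) : Prop where
  smooth_proj : CSmooth π
  surj : Function.Surjective π
  locTriv : ∀ b : B, ∃ U : Set B, IsOpen U ∧ b ∈ U ∧
    ∃ φ : {e : E // π e ∈ U} ≃ U × F,
      CSmooth ⇑φ ∧ CSmooth ⇑φ.symm ∧
      ∀ e : {e : E // π e ∈ U}, ((φ e).1 : B) = π (e : E)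

/-- `G` has *good orbit* at `x ∈ Q`, relative to a given notion `ISS` of initial
splitting smooth submanifolds of `Q`: the orbit is an initial splitting smooth
submanifold, and the action on it is smooth and admits local smooth sections. -/
def HasGoodOrbitAt (G Q : Type*) [Group G] [SmoothCurves G] [SmoothCurves Q]
    [TopologicalSpace Q] [MulAction G Q] (ISS : Set Q → Prop) (x : Q) : Prop :=
  ISS (MulAction.orbit G x) ∧
  SmoothAction G (MulAction.orbit G x) ∧
  AdmitsLocalSmoothSections G (MulAction.orbit G x)

/-- Good orbit at `x ∈ Q` for a subgroup `Gsub` of an ambient regular Lie group `H`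
(all smoothness requirements relative to `H`). -/
def HasGoodOrbitAtSub (H : Type*) [Group H] [SmoothCurves H] (Gsub : Subgroup H)
    (Q : Type*) [SmoothCurves Q] [TopologicalSpace Q] [MulAction H Q]
    (ISS : Set Q → Prop) (x : Q) : Prop :=
  let O : Set Q := Set.range fun g : Gsub => (g : H) • x
  ISS O ∧
  CSmooth (fun p : Gsub × O => (p.1 : H) • ((p.2 : Q))) ∧
  ∀ y : O, ∃ U : Set O, IsOpen U ∧ y ∈ U ∧
    ∃ u : U → H, CSmooth u ∧ ∀ z : U, u z ∈ Gsub ∧ u z • (y : Q) = ((z : O) : Q)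

/-- The identity component of a convenient Lie group, described by smooth arcs. -/
def smoothIdentityComponent (G : Type*) [Group G] [SmoothCurves G]
    [ConvenientLieGroup G] : Subgroup G where
  carrier := {g | ∃ c ∈ SmoothCurves.curves (X := G), c 0 = 1 ∧ c 1 = g}
  one_mem' := ⟨fun _ => 1, SmoothCurves.const_mem 1, rfl, rfl⟩
  mul_mem' := by
    rintro a b ⟨c, hc, hc0, hc1⟩ ⟨d, hd, hd0, hd1⟩
    exact ⟨fun t => c t * d t,
      ConvenientLieGroup.smooth_mul (fun t => (c t, d t)) ⟨hc, hd⟩,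
      by simp [hc0, hd0], by simp [hc1, hd1]⟩
  inv_mem' := by
    rintro a ⟨c, hc, hc0, hc1⟩
    exact ⟨fun t => (c t)⁻¹, ConvenientLieGroup.smooth_inv c hc,
      by simp [hc0], by simp [hc1]⟩

instance Subgroup.convenientLieGroup {G : Type*} [Group G] [SmoothCurves G]
    [ConvenientLieGroup G] (K : Subgroup G) : ConvenientLieGroup K where
  smooth_mul := fun c hc => ConvenientLieGroup.smooth_mul (G := G)
    (fun t => (((c t).1 : G), ((c t).2 : G)))
    ⟨by exact hc.1, by exact hc.2⟩
  smooth_inv := fun c hc => ConvenientLieGroup.smooth_inv (G := G)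
    (fun t => ((c t : K) : G)) hc

/-- Abstract data exhibiting `Gr` as the nonlinear Grassmannian of closed submanifolds
of `M`, compatibly with the `G` actions. -/
structure GrassmannianData (G M Gr : Type*) [TopologicalSpace M] [SMul G M]
    [SMul G Gr] where
  toSet : Gr → Set M
  inj : Function.Injective toSet
  closed : ∀ N, IsClosed (toSet N)
  equivariant : ∀ (g : G) (N : Gr), toSet (g • N) = (fun x => g • x) '' toSet N

/-!
## Statement 3 (Lemma 2.7 of the paper)

For a Lie group `G` acting smoothly on a finite-dimensional manifold `M` (hence on
the nonlinear Grassmannian `Gr(M)`), if `G` has good orbit and good isotropy at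
`N ∈ Gr(M)`, then the orbit map `G → G·N`, `g ↦ g·N`, is a smooth principal bundle
with structure group the isotropy group `G_N`.
-/
theorem orbit_map_is_principal_bundle
    {G M Gr : Type*} [Group G] [SmoothCurves G] [ConvenientLieGroup G]
    -- the finite-dimensional manifold `M`, with a smooth `G` action:
    [TopologicalSpace M] [MulAction G M]
    -- the nonlinear Grassmannian `Gr = Gr(M)` of closed submanifolds of `M`,
    -- a Fréchet manifold with the induced smooth `G` action:
    [TopologicalSpace Gr] [SmoothCurves Gr] [MulAction G Gr] [SmoothAction G Gr]
    (grass : GrassmannianData G M Gr)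
    -- a notion of initial splitting smooth submanifolds of `Gr(M)`:
    (ISS : Set Gr → Prop)
    -- a notion of splitting Lie subgroups of `G`:
    (SplittingLieSubgroup : Subgroup G → Prop)
    (N : Gr)
    -- `G` has good orbit at `N`:
    (hOrbit : HasGoodOrbitAt G Gr ISS N)
    -- `G` has good isotropy at `N`: `G_N` is a splitting Lie subgroup of `G`:
    (hIso : SplittingLieSubgroup (MulAction.stabilizer G N)) :
    -- the orbit map `G → G·N`, `g ↦ g·N`, is a smooth principal bundle with
    -- structure group `G_N` (acting on `G` by right translations):
    IsSmoothPrincipalBundle (MulAction.stabilizer G N) G (MulAction.orbit G N)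
      (fun g : G => ⟨g • N, ⟨g, rfl⟩⟩)
      (fun g h => g * (h : G)) := by
  have smooth_proj : CSmooth fun g : G => (⟨g • N, ⟨g, rfl⟩⟩ : MulAction.orbit G N) :=
    fun c hc => SmoothAction.smooth_smul (G := G) (Q := Gr) (fun t => (c t, N))
      ⟨hc, SmoothCurves.const_mem N⟩
  have smooth_mul : ∀ c d : ℝ → G, c ∈ SmoothCurves.curves → d ∈ SmoothCurves.curves →
      (fun t => c t * d t) ∈ SmoothCurves.curves :=
    fun c d hc hd => ConvenientLieGroup.smooth_mul (fun t => (c t, d t)) ⟨hc, hd⟩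
  have smooth_inv : ∀ c : ℝ → G, c ∈ SmoothCurves.curves →
      (fun t => (c t)⁻¹) ∈ SmoothCurves.curves :=
    fun c hc => ConvenientLieGroup.smooth_inv c hc
  have mul_stabilizer_smul : ∀ (g : G) (h : MulAction.stabilizer G N),
      (g * (h : G)) • N = g • N := fun g h => by rw [mul_smul, h.2]
  refine
    { smooth_proj := smooth_proj
      surj := fun ⟨_, g, hg⟩ => ⟨g, Subtype.ext hg⟩
      ract_one := fun p => mul_one p
      ract_mul := fun p h h' => mul_assoc p h h'
      smooth_ract := fun c hc => smooth_mul _ _ hc.1 hc.2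
      proj_ract := fun p h => Subtype.ext (mul_stabilizer_smul p h)
      free := fun p h hp => Subtype.ext (mul_eq_left.mp hp)
      locTriv := fun b => ?_ }
  obtain ⟨U, hU, hbU, u, hu, hub⟩ := hOrbit.2.2 b
  obtain ⟨g₀, hg₀⟩ : ∃ g : G, g • N = b := b.2
  -- the section `y ↦ u y * g₀` of the orbit map over `U`
  have section_smul : ∀ y : U, (u y * g₀) • N = ((y : MulAction.orbit G N) : Gr) := fun y => by
    rw [mul_smul, hg₀]
    exact congrArg Subtype.val (hub y)
  refine ⟨U, hU, hbU,
    { toFun := fun p => ⟨⟨_, p.2⟩, (u ⟨_, p.2⟩ * g₀)⁻¹ * p, ?_⟩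
      invFun := fun q => ⟨u q.1 * g₀ * q.2, ?_⟩
      left_inv := fun p => Subtype.ext (mul_inv_cancel_left _ _)
      right_inv := ?_ }, ?_, ?_, fun p => rfl, ?_⟩
  · rw [MulAction.mem_stabilizer_iff, mul_smul, inv_smul_eq_iff, section_smul]
  · convert q.1.2 using 1
    exact Subtype.ext ((mul_stabilizer_smul _ _).trans (section_smul q.1))
  · rintro ⟨y, h⟩
    have hy : (⟨(u y * g₀ * (h : G)) • N, ⟨_, rfl⟩⟩ : MulAction.orbit G N) = y :=
      Subtype.ext ((mul_stabilizer_smul _ _).trans (section_smul y))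
    refine Prod.ext (Subtype.ext hy) (Subtype.ext ?_)
    simp only [hy, Subtype.coe_eta, inv_mul_cancel_left]
  · intro c hc
    have hπ := smooth_proj _ hc
    exact ⟨hπ, smooth_mul _ _
      (smooth_inv _ (smooth_mul _ _ (hu (fun t => ⟨_, (c t).2⟩) hπ) (SmoothCurves.const_mem g₀)))
      hc⟩
  · exact fun c hc => smooth_mul _ _
      (smooth_mul _ _ (hu _ hc.1) (SmoothCurves.const_mem g₀)) hc.2
  · rintro ⟨p, hp⟩ ⟨q, hq⟩ h hqp
    obtain rfl : q = p * (h : G) := hqp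
    have hπ : (⟨(p * (h : G)) • N, ⟨_, rfl⟩⟩ : MulAction.orbit G N) = ⟨p • N, ⟨p, rfl⟩⟩ :=
      Subtype.ext (mul_stabilizer_smul p h)
    refine Subtype.ext ?_
    simp only [Equiv.coe_fn_mk, hπ, Subgroup.coe_mul, mul_assoc]
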